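/- arXiv:2105.07925 — 4 statements merged into one kernel-verified Lean document; each statement's English description precedes it below -/
import Mathlib

section
/- For every ε with 0 < ε < 1, the function u : ℝ² → ℝ defined by u(x) = (1−ε)·(‖x‖/ε)^ε satisfies ∫_{B(0,ε)} ‖∇u(x)‖² dx = π·ε·(1−ε)², where B(0,ε) is the open ball of radius ε centered at the origin, ∇u is the gradient of u, and the integral is with respect to two-dimensional Lebesgue measure. -/
open Real MeasureTheory

/-- The gradient of a radial function `φ ‖·‖` has norm `|φ'|` away from the origin. -/
theorem norm_gradient_comp_norm {E : Type*} [NormedAddCommGroup E] [InnerProductSpace ℝ E]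
    [CompleteSpace E] {φ : ℝ → ℝ} {φ' : ℝ} {x : E} (hx : x ≠ 0) (hφ : HasDerivAt φ φ' ‖x‖) :
    ‖gradient (fun y : E => φ ‖y‖) x‖ = |φ'| := by
  have : Nontrivial E := ⟨x, 0, hx⟩
  have hd : DifferentiableAt ℝ (fun y : E => ‖y‖) x := differentiableAt_id.norm ℝ hx
  have hφn : HasFDerivAt (fun y : E => φ ‖y‖) (φ' • fderiv ℝ (fun y : E => ‖y‖) x) x :=
    hφ.comp_hasFDerivAt x hd.hasFDerivAt
  rw [gradient, LinearIsometryEquiv.norm_map, hφn.fderiv, norm_smul, norm_fderiv_norm hd,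
    mul_one, Real.norm_eq_abs]

/-- Integration of a radial function over a disc centred at the origin of the Euclidean plane. -/
theorem setIntegral_ball_fun_norm (f : ℝ → ℝ) {R : ℝ} (hR : 0 ≤ R) :
    ∫ x : EuclideanSpace ℝ (Fin 2) in Metric.ball 0 R, f ‖x‖ =
      2 * π * ∫ r in (0 : ℝ)..R, r * f r := by
  have hball : (fun x : EuclideanSpace ℝ (Fin 2) => (Set.Iio R).indicator f ‖x‖) =
      (Metric.ball 0 R).indicator fun x => f ‖x‖ := by
    ext x
    simp [Set.indicator]
  have hvol : (volume : Measure (EuclideanSpace ℝ (Fin 2))).real (Metric.ball 0 1) = π := by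
    simp [Measure.real, pi_nonneg]
  have hind : (fun r : ℝ => r * (Set.Iio R).indicator f r) =
      (Set.Iio R).indicator fun r => r * f r := by
    ext r
    by_cases hr : r < R <;> simp [hr]
  have h := integral_fun_norm_addHaar (volume : Measure (EuclideanSpace ℝ (Fin 2)))
    ((Set.Iio R).indicator f)
  rw [hball, integral_indicator Metric.isOpen_ball.measurableSet, hvol] at h
  rw [h, intervalIntegral.integral_of_le hR, integral_Ioc_eq_integral_Ioo]
  simp only [finrank_euclideanSpace, Fintype.card_fin, Nat.add_one_sub_one, pow_one, smul_eq_mul,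
    nsmul_eq_mul, Nat.cast_ofNat, hind]
  rw [setIntegral_indicator measurableSet_Iio, Set.Ioi_inter_Iio, mul_assoc]

/-- Dirichlet energy of the radial function `u x = (1-ε) * (‖x‖/ε)^ε` on the
ball `B(0,ε)` in `ℝ²` equals `π ε (1-ε)²`. -/
theorem stmt_0 (ε : ℝ) (hε0 : 0 < ε) (hε1 : ε < 1) :
    ∫ x : EuclideanSpace ℝ (Fin 2) in Metric.ball 0 ε,
      ‖gradient (fun y : EuclideanSpace ℝ (Fin 2) => (1 - ε) * (‖y‖ / ε) ^ ε) x‖ ^ 2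
      = π * ε * (1 - ε) ^ 2 := by
  have hderiv {r : ℝ} (hr : 0 < r) :
      HasDerivAt (fun s : ℝ => (1 - ε) * (s / ε) ^ ε) ((1 - ε) * (r / ε) ^ (ε - 1)) r := by
    convert! (((hasDerivAt_id r).div_const ε).rpow_const (p := ε)
      (Or.inl (div_pos hr hε0).ne')).const_mul (1 - ε) using 1
    simp only [id]
    field_simp
  have hnorm : ∀ᵐ x : EuclideanSpace ℝ (Fin 2) ∂volume.restrict (Metric.ball 0 ε),
      ‖gradient (fun y : EuclideanSpace ℝ (Fin 2) => (1 - ε) * (‖y‖ / ε) ^ ε) x‖ ^ 2 =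
        ((1 - ε) * (‖x‖ / ε) ^ (ε - 1)) ^ 2 := by
    filter_upwards [ae_restrict_of_ae (Measure.ae_ne volume 0)] with x hx
    rw [norm_gradient_comp_norm hx (hderiv (norm_pos_iff.mpr hx)), sq_abs]
  have hint : Set.EqOn (fun r : ℝ => r * ((1 - ε) * (r / ε) ^ (ε - 1)) ^ 2)
      (fun r => (1 - ε) ^ 2 * ((ε ^ (ε - 1)) ^ 2)⁻¹ * r ^ (2 * ε - 1)) (Set.uIoo 0 ε) := by
    intro r hr
    rw [Set.uIoo_of_le hε0.le] at hr
    have hpow : r ^ (2 * ε - 1) = r * (r ^ (ε - 1)) ^ 2 := by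
      rw [← rpow_mul_natCast hr.1.le]
      nth_rw 2 [← rpow_one r]
      rw [← rpow_add hr.1]
      congr 1
      push_cast
      ring
    simp only [hpow, div_rpow hr.1.le hε0.le]
    field_simp
  rw [integral_congr_ae hnorm,
    setIntegral_ball_fun_norm (fun r => ((1 - ε) * (r / ε) ^ (ε - 1)) ^ 2) hε0.le,
    intervalIntegral.integral_congr_uIoo hint, intervalIntegral.integral_const_mul,
    integral_rpow (Or.inl (by linarith)), sub_add_cancel, zero_rpow (by positivity)]
  have hpow : ε ^ (2 * ε) = (ε ^ (ε - 1)) ^ 2 * ε ^ 2 := by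
    rw [← mul_pow, rpow_sub_one hε0.ne', div_mul_cancel₀ _ hε0.ne', ← rpow_mul_natCast hε0.le]
    congr 1
    push_cast
    ring
  rw [hpow]
  field_simp
  ring
end

section
/- For every ε with 0 < ε < 1, ∫_0^1 ρ_ε(r)²/r dr ≤ 1/(2ε) − log ε, where ρ_ε : (0,∞) → ℝ is defined by ρ_ε(r) = (1−ε)(r/ε)^ε for 0 < r < ε, ρ_ε(r) = 1−r for ε ≤ r ≤ 1, and ρ_ε(r) = 0 for r > 1. -/
open Real MeasureTheory intervalIntegral

/-- The radial cut-off function `ρ_ε`: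
`ρ_ε(r) = (1-ε)(r/ε)^ε` for `0 < r < ε`, `ρ_ε(r) = 1-r` for `ε ≤ r ≤ 1`,
and `ρ_ε(r) = 0` for `r > 1`. -/
noncomputable def rhoCut (ε r : ℝ) : ℝ :=
  if r < ε then (1 - ε) * (r / ε) ^ ε
  else if r ≤ 1 then 1 - r
  else 0

lemma rhoCut_sq_div_eq_rpow {ε r : ℝ} (hε0 : 0 < ε) (hε1 : ε < 1) (hr0 : 0 < r) (hr : r ≤ ε) :
    (rhoCut ε r) ^ 2 / r = (1 - ε) ^ 2 * (ε ^ (2 * ε))⁻¹ * r ^ (2 * ε - 1) := by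
  have hρ : rhoCut ε r = (1 - ε) * (r / ε) ^ ε := by
    rcases hr.lt_or_eq with h | rfl
    · simp [rhoCut, h]
    · simp [rhoCut, hε1.le, div_self hε0.ne']
  have hsq : ∀ x : ℝ, 0 < x → x ^ (2 * ε) = (x ^ ε) ^ 2 := fun x hx ↦ by
    rw [mul_comm, rpow_mul hx.le, rpow_two]
  rw [hρ, rpow_sub_one hr0.ne', hsq r hr0, hsq ε hε0, div_rpow hr0.le hε0.le]
  have := (rpow_pos_of_pos hε0 ε).ne'
  field_simp

lemma rhoCut_sq_div_eq_of_mem_Icc {ε r : ℝ} (hr : r ∈ Set.Icc ε 1) :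
    (rhoCut ε r) ^ 2 / r = (1 - r) ^ 2 / r := by
  simp [rhoCut, hr.1.not_gt, hr.2]

/-- Inequality (3.2b): `∫_0^1 ρ_ε(r)²/r dr ≤ 1/(2ε) − log ε`. -/
theorem stmt_2 (ε : ℝ) (hε0 : 0 < ε) (hε1 : ε < 1) :
    ∫ r in (0:ℝ)..1, (rhoCut ε r) ^ 2 / r ≤ 1 / (2 * ε) - Real.log ε := by
  have eq_inner : Set.EqOn (fun r ↦ (1 - ε) ^ 2 * (ε ^ (2 * ε))⁻¹ * r ^ (2 * ε - 1))
      (fun r ↦ (rhoCut ε r) ^ 2 / r) (Set.uIoc 0 ε) := fun r hr ↦ by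
    rw [Set.uIoc_of_le hε0.le] at hr
    exact (rhoCut_sq_div_eq_rpow hε0 hε1 hr.1 hr.2).symm
  have eq_outer : Set.EqOn (fun r ↦ (1 - r) ^ 2 / r)
      (fun r ↦ (rhoCut ε r) ^ 2 / r) (Set.uIcc ε 1) := fun r hr ↦ by
    rw [Set.uIcc_of_le hε1.le] at hr
    exact (rhoCut_sq_div_eq_of_mem_Icc hr).symm
  have zero_notMem : (0 : ℝ) ∉ Set.uIcc ε 1 := by
    rw [Set.uIcc_of_le hε1.le]
    exact fun h ↦ hε0.not_ge h.1
  have ne_zero : ∀ r ∈ Set.uIcc ε 1, r ≠ 0 := fun r hr h ↦ zero_notMem (h ▸ hr)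
  have int_inner : IntervalIntegrable (fun r ↦ (rhoCut ε r) ^ 2 / r) volume 0 ε :=
    ((intervalIntegrable_rpow' (by linarith)).const_mul _).congr eq_inner
  have int_quot : IntervalIntegrable (fun r : ℝ ↦ (1 - r) ^ 2 / r) volume ε 1 :=
    ContinuousOn.intervalIntegrable (ContinuousOn.div (by fun_prop) (by fun_prop) ne_zero)
  have int_outer : IntervalIntegrable (fun r ↦ (rhoCut ε r) ^ 2 / r) volume ε 1 :=
    int_quot.congr (eq_outer.mono Set.uIoc_subset_uIcc)
  have inner_le : ∫ r in (0:ℝ)..ε, (rhoCut ε r) ^ 2 / r ≤ 1 / (2 * ε) := by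
    rw [← integral_congr_ae (.of_forall eq_inner), intervalIntegral.integral_const_mul,
      integral_rpow (Or.inl (by linarith)), sub_add_cancel, zero_rpow (by positivity), sub_zero]
    have hpos := (rpow_pos_of_pos hε0 (2 * ε)).ne'
    calc (1 - ε) ^ 2 * (ε ^ (2 * ε))⁻¹ * (ε ^ (2 * ε) / (2 * ε)) = (1 - ε) ^ 2 / (2 * ε) := by
          field_simp
      _ ≤ 1 / (2 * ε) := by
          gcongr
          nlinarith
  have outer_le : ∫ r in ε..1, (rhoCut ε r) ^ 2 / r ≤ -Real.log ε := by
    rw [← integral_congr eq_outer]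
    calc ∫ r in ε..1, (1 - r) ^ 2 / r ≤ ∫ r in ε..1, 1 / r := by
          refine integral_mono_on hε1.le int_quot
            (ContinuousOn.intervalIntegrable
              (ContinuousOn.div (by fun_prop) (by fun_prop) ne_zero)) fun r hr ↦ ?_
          have hr0 : 0 < r := hε0.trans_le hr.1
          gcongr
          nlinarith [hr.2]
      _ = -Real.log ε := by
          rw [integral_one_div zero_notMem, one_div, Real.log_inv]
  rw [← integral_add_adjacent_intervals int_inner int_outer]
  linarith
end

section
/- There exists a constant C > 0 such that for every ε with 0 < ε < 1, 2ε² · ∫_0^1 ∫_{π/2}^{π} [ r·D_ε(r)²·(3 − 4θ/π)² + (16/(π² r))·ρ_ε(r)² ] dθ dr ≤ C·ε, where ρ_ε : (0,∞) → ℝ is defined by ρ_ε(r) = (1−ε)(r/ε)^ε for 0 < r < ε, ρ_ε(r) = 1−r for ε ≤ r ≤ 1, and ρ_ε(r) = 0 for r > 1, and D_ε(r) = (1−ε)·ε·r^{ε−1}/ε^ε for 0 < r < ε, D_ε(r) = −1 for ε < r < 1, D_ε(r) = 0 for r > 1 is its piecewise derivative. -/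
open Real MeasureTheory intervalIntegral

/-- Its piecewise derivative `D_ε`. -/
noncomputable def Dcut (ε r : ℝ) : ℝ :=
  if r < ε then (1 - ε) * ε * r ^ (ε - 1) / ε ^ ε
  else if r ≤ 1 then -1
  else 0

theorem rpow_self_inv_le {ε : ℝ} (h0 : 0 < ε) : (ε ^ ε)⁻¹ ≤ exp 1 := by
  rw [rpow_def_of_pos h0, ← Real.exp_neg, Real.exp_le_exp]
  have h := one_sub_inv_le_log_of_pos h0
  have h' := mul_le_mul_of_nonneg_right h h0.le
  rw [sub_mul, inv_mul_cancel₀ h0.ne'] at h'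
  linarith

theorem sq_div_rpow_le {ε r : ℝ} (h0 : 0 < ε) (hr : 0 < r) :
    ((r / ε) ^ ε) ^ 2 ≤ exp 1 ^ 2 * r ^ (2 * ε) := by
  have h1 : (r / ε) ^ ε ≤ exp 1 * r ^ ε := by
    rw [div_rpow hr.le h0.le, div_eq_mul_inv, mul_comm]
    exact mul_le_mul_of_nonneg_right (rpow_self_inv_le h0) (by positivity)
  have h2 : r ^ (2 * ε) = (r ^ ε) ^ 2 := by
    rw [← rpow_mul_natCast hr.le]
    congr 1
    push_cast
    ring
  rw [h2, ← mul_pow]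
  exact pow_le_pow_left₀ (by positivity) h1 2

theorem rhoCut_sq_le {ε r : ℝ} (h0 : 0 < ε) (h1 : ε < 1) (hr : 0 < r) :
    rhoCut ε r ^ 2 ≤ ((r / ε) ^ ε) ^ 2 := by
  unfold rhoCut
  split_ifs with h h'
  · have : 0 < (r / ε) ^ ε := by positivity
    exact pow_le_pow_left₀ (mul_nonneg (by linarith) this.le) (by nlinarith) 2
  · have : 1 ≤ (r / ε) ^ ε :=
      one_le_rpow ((one_le_div h0).2 (not_lt.1 h)) h0.le
    exact pow_le_pow_left₀ (by linarith) (by linarith) 2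
  · rw [zero_pow two_ne_zero]
    positivity

theorem mul_Dcut_sq_le {ε r : ℝ} (h0 : 0 < ε) (h1 : ε < 1) (hr : 0 < r) :
    (r * Dcut ε r) ^ 2 ≤ ((r / ε) ^ ε) ^ 2 := by
  unfold Dcut
  split_ifs with h h'
  · have : 0 < (r / ε) ^ ε := by positivity
    have e : r * ((1 - ε) * ε * r ^ (ε - 1) / ε ^ ε) = ((1 - ε) * ε) * (r / ε) ^ ε := by
      rw [div_rpow hr.le h0.le, rpow_sub_one hr.ne']
      field_simp
    rw [e]
    exact pow_le_pow_left₀ (mul_nonneg (mul_nonneg (by linarith) h0.le) this.le)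
      (mul_le_of_le_one_left this.le (by nlinarith)) 2
  · have : 1 ≤ (r / ε) ^ ε :=
      one_le_rpow ((one_le_div h0).2 (not_lt.1 h)) h0.le
    nlinarith
  · rw [mul_zero, zero_pow two_ne_zero]
    positivity

theorem angular_energy_le {ε r θ : ℝ} (h0 : 0 < ε) (h1 : ε < 1) (hr : 0 < r)
    (hθ : π / 2 ≤ θ) (hθ' : θ ≤ π) :
    r * (Dcut ε r) ^ 2 * (3 - 4 * θ / π) ^ 2 + (16 / (π ^ 2 * r)) * (rhoCut ε r) ^ 2
      ≤ 3 * exp 1 ^ 2 * r ^ (2 * ε - 1) := by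
  have hπ := pi_pos
  have hs : (3 - 4 * θ / π) ^ 2 ≤ 1 := by
    rw [sq_le_one_iff_abs_le_one, abs_le]
    have a : 4 * θ / π ≤ 4 := by rw [div_le_iff₀ hπ]; linarith
    have b : 2 ≤ 4 * θ / π := by rw [le_div_iff₀ hπ]; linarith
    constructor <;> linarith
  have hp : 16 / π ^ 2 ≤ 2 := by
    rw [div_le_iff₀ (by positivity)]
    nlinarith [pi_gt_three]
  have hT := sq_div_rpow_le h0 hr
  have hD := (mul_Dcut_sq_le h0 h1 hr).trans hT
  have hR := (rhoCut_sq_le h0 h1 hr).trans hT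
  have e : r * (Dcut ε r) ^ 2 * (3 - 4 * θ / π) ^ 2 + (16 / (π ^ 2 * r)) * (rhoCut ε r) ^ 2
      = ((r * Dcut ε r) ^ 2 * (3 - 4 * θ / π) ^ 2 + 16 / π ^ 2 * rhoCut ε r ^ 2) / r := by
    field_simp
  rw [e, rpow_sub_one hr.ne', ← mul_div_assoc]
  refine div_le_div_of_nonneg_right ?_ hr.le
  have a := mul_le_mul hD hs (sq_nonneg _) (by positivity)
  have b := mul_le_mul hp hR (sq_nonneg _) (by norm_num)
  linarith

/-- Estimate (4.6): the weighted Dirichlet energy (in polar coordinates) of the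
counterexample function on the second quadrant, times `ε²`, is `≲ ε` uniformly in `ε`. -/
theorem stmt_3 :
    ∃ C : ℝ, 0 < C ∧ ∀ ε : ℝ, 0 < ε → ε < 1 →
      2 * ε ^ 2 *
        ∫ r in (0:ℝ)..1, ∫ θ in (π/2)..π,
          (r * (Dcut ε r) ^ 2 * (3 - 4 * θ / π) ^ 2
            + (16 / (π ^ 2 * r)) * (rhoCut ε r) ^ 2)
        ≤ C * ε := by
  have hπ := pi_pos
  refine ⟨3 * exp 1 ^ 2 * (π / 2), by positivity, fun ε h0 h1 => ?_⟩
  have key : ∫ r in (0:ℝ)..1, ∫ θ in (π/2)..π,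
          (r * (Dcut ε r) ^ 2 * (3 - 4 * θ / π) ^ 2
            + (16 / (π ^ 2 * r)) * (rhoCut ε r) ^ 2)
      ≤ ∫ r in (0:ℝ)..1, 3 * exp 1 ^ 2 * (π / 2) * r ^ (2 * ε - 1) := by
    rw [integral_of_le zero_le_one, integral_of_le zero_le_one]
    refine integral_mono_of_nonneg ?_ ?_ ?_
    · filter_upwards [ae_restrict_mem measurableSet_Ioc] with r hr
      have := hr.1
      exact intervalIntegral.integral_nonneg (by linarith) fun θ _ => by positivity
    · rw [← IntegrableOn, ← intervalIntegrable_iff_integrableOn_Ioc_of_le zero_le_one]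
      exact (intervalIntegrable_rpow' (by linarith)).const_mul _
    · filter_upwards [ae_restrict_mem measurableSet_Ioc] with r hr
      refine (intervalIntegral.integral_mono_on (g := fun _ => 3 * exp 1 ^ 2 * r ^ (2 * ε - 1))
        (by linarith) (Continuous.intervalIntegrable (by fun_prop) _ _)
        (Continuous.intervalIntegrable (by fun_prop) _ _)
        fun θ hθ => angular_energy_le h0 h1 hr.1 hθ.1 hθ.2).trans_eq ?_
      rw [intervalIntegral.integral_const, smul_eq_mul]
      ring
  rw [intervalIntegral.integral_const_mul, integral_rpow (Or.inl (by linarith)), sub_add_cancel,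
    one_rpow, zero_rpow (by positivity)] at key
  refine (mul_le_mul_of_nonneg_left key (by positivity)).trans_eq ?_
  field_simp
  ring
end

section
/- Define g : ℝ → ℝ by g(θ) = cos θ + sin θ − 1, and for ε ∈ (0,1/2] define ũ_ε(r,θ) = g(θ)·(1 − r(cos θ + sin θ))/(1 − ε(cos θ + sin θ)). Then there exists a constant C > 0, independent of ε, such that for all ε ∈ (0,1/2], all r ∈ [0,1] and all θ ∈ [0,π/2], |∂ũ_ε/∂r(r,θ)| ≤ C and |∂ũ_ε/∂θ(r,θ)| ≤ C. -/
open Real Set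

/-- The comparison function `ũ_ε(r,θ) = g(θ)·(1 − r(cos θ + sin θ))/(1 − ε(cos θ + sin θ))`
with `g(θ) = cos θ + sin θ − 1`, written in polar coordinates. -/
noncomputable def uTilde (ε r θ : ℝ) : ℝ :=
  (Real.cos θ + Real.sin θ - 1) * (1 - r * (Real.cos θ + Real.sin θ)) /
    (1 - ε * (Real.cos θ + Real.sin θ))

theorem hasDerivAt_uTilde_radius (ε r θ : ℝ) :
    HasDerivAt (fun r' => uTilde ε r' θ)
      ((cos θ + sin θ - 1) * -(cos θ + sin θ) / (1 - ε * (cos θ + sin θ))) r := by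
  have h := ((((hasDerivAt_id r).mul_const (cos θ + sin θ)).const_sub 1).const_mul
    (cos θ + sin θ - 1)).div_const (1 - ε * (cos θ + sin θ))
  simpa [uTilde] using h

theorem hasDerivAt_uTilde_angle {ε θ : ℝ} (r : ℝ) (h0 : 1 - ε * (cos θ + sin θ) ≠ 0) :
    HasDerivAt (fun θ' => uTilde ε r θ')
      ((cos θ - sin θ) *
        ((1 - r * (cos θ + sin θ) - (cos θ + sin θ - 1) * r) * (1 - ε * (cos θ + sin θ)) +
          (cos θ + sin θ - 1) * (1 - r * (cos θ + sin θ)) * ε) /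
        (1 - ε * (cos θ + sin θ)) ^ 2) θ := by
  have hs := (hasDerivAt_cos θ).add (hasDerivAt_sin θ)
  have h := ((hs.sub_const 1).mul ((hs.const_mul r).const_sub 1)).div
    ((hs.const_mul ε).const_sub 1) h0
  refine h.congr_deriv ?_
  simp only [Pi.add_apply, Pi.mul_apply]
  ring

theorem abs_cos_add_sin_le (θ : ℝ) : |cos θ + sin θ| ≤ 3 / 2 :=
  abs_le_of_sq_le_sq (by nlinarith [sq_nonneg (cos θ - sin θ), sin_sq_add_cos_sq θ]) (by norm_num)

theorem abs_cos_sub_sin_le (θ : ℝ) : |cos θ - sin θ| ≤ 3 / 2 :=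
  abs_le_of_sq_le_sq (by nlinarith [sq_nonneg (cos θ + sin θ), sin_sq_add_cos_sq θ]) (by norm_num)

theorem abs_div_le_of_le {a b A B C : ℝ} (ha : |a| ≤ A) (hB : 0 < B) (hb : B ≤ b)
    (hAC : A ≤ C * B) : |a / b| ≤ C := by
  have hA : 0 ≤ A := (abs_nonneg a).trans ha
  rw [abs_div, abs_of_pos (hB.trans_le hb)]
  exact (div_le_div₀ hA ha hB hb).trans ((div_le_iff₀ hB).2 hAC)

theorem abs_mul_le_of_le {a b A B : ℝ} (ha : |a| ≤ A) (hb : |b| ≤ B) : |a * b| ≤ A * B := by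
  rw [abs_mul]
  exact mul_le_mul ha hb (abs_nonneg b) ((abs_nonneg a).trans ha)

/-- The polar partial derivatives of `ũ_ε` are bounded uniformly in `ε ∈ (0,1/2]`,
`r ∈ [0,1]`, `θ ∈ [0,π/2]`. -/
theorem stmt_5 :
    ∃ C : ℝ, 0 < C ∧ ∀ ε : ℝ, ε ∈ Ioc (0:ℝ) (1/2) → ∀ r ∈ Icc (0:ℝ) 1,
      ∀ θ ∈ Icc (0:ℝ) (π/2),
        |deriv (fun r' => uTilde ε r' θ) r| ≤ C ∧
        |deriv (fun θ' => uTilde ε r θ') θ| ≤ C := by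
  refine ⟨300, by norm_num, fun ε ⟨hε0, hε⟩ r ⟨hr0, hr⟩ θ _ => ?_⟩
  have hs := abs_cos_add_sin_le θ
  have ht := abs_cos_sub_sin_le θ
  have hεs : |ε * (cos θ + sin θ)| ≤ 1 / 2 * (3 / 2) :=
    abs_mul_le_of_le (abs_le.2 ⟨by linarith, hε⟩) hs
  have hrs : |r * (cos θ + sin θ)| ≤ 1 * (3 / 2) :=
    abs_mul_le_of_le (abs_le.2 ⟨by linarith, hr⟩) hs
  have hD : 1 / 4 ≤ 1 - ε * (cos θ + sin θ) := by linarith [(abs_le.1 hεs).2]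
  have hr' : |r| ≤ 1 := abs_le.2 ⟨by linarith, hr⟩
  have hε' : |ε| ≤ 1 / 2 := abs_le.2 ⟨by linarith, hε⟩
  rw [(hasDerivAt_uTilde_radius ε r θ).deriv,
    (hasDerivAt_uTilde_angle r (by linarith : 1 - ε * (cos θ + sin θ) ≠ 0)).deriv]
  generalize cos θ + sin θ = s at *
  generalize cos θ - sin θ = t at *
  have hg : |s - 1| ≤ 5 / 2 := (abs_sub s 1).trans (by rw [abs_one]; linarith)
  have hN : |1 - r * s| ≤ 5 / 2 := (abs_sub 1 _).trans (by rw [abs_one]; linarith)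
  have hD' : |1 - ε * s| ≤ 7 / 4 := (abs_sub 1 _).trans (by rw [abs_one]; linarith)
  constructor
  · exact abs_div_le_of_le (abs_mul_le_of_le hg ((abs_neg s).trans_le hs)) (by norm_num) hD
      (by norm_num)
  · have hN' : |1 - r * s - (s - 1) * r| ≤ 5 / 2 + 5 / 2 * 1 :=
      (abs_sub _ _).trans (add_le_add hN (abs_mul_le_of_le hg hr'))
    exact abs_div_le_of_le
      (abs_mul_le_of_le ht ((abs_add_le _ _).trans (add_le_add (abs_mul_le_of_le hN' hD')
        (abs_mul_le_of_le (abs_mul_le_of_le hg hN) hε'))))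
      (by norm_num) (pow_le_pow_left₀ (by norm_num) hD 2) (by norm_num)
end
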